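/- For all integers k ≥ 1 and ℓ ≥ 3 there exists a skewness-k simple graph G with exactly n = 11ℓk − 5k + 1 vertices such that cr_{skew-k}(G) ≥ ℓk and cr(G) ≤ 3k (hence the skewness-k crossing ratio is Ω(n/k)). -/

import Mathlib

open Set

noncomputable section

/-- A drawing of a simple graph in the plane: vertices are mapped to distinct
points, each edge `uv` is drawn as a simple arc joining the images of `u` and
`v` and avoiding the images of the other vertices, any two arcs meet in
finitely many points, and no three arcs pass through a common non-vertex
point. -/
structure Drawing {V : Type} (G : SimpleGraph V) where
  vpos : V → ℝ × ℝ
  vpos_inj : Function.Injective vpos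
  arc : V → V → ℝ → ℝ × ℝ
  arc_symm : ∀ u v t, arc u v t = arc v u (1 - t)
  arc_cont : ∀ u v, G.Adj u v → ContinuousOn (arc u v) (Set.Icc 0 1)
  arc_injOn : ∀ u v, G.Adj u v → Set.InjOn (arc u v) (Set.Icc 0 1)
  arc_start : ∀ u v, G.Adj u v → arc u v 0 = vpos u
  arc_end : ∀ u v, G.Adj u v → arc u v 1 = vpos v
  arc_avoids : ∀ u v, G.Adj u v → ∀ t ∈ Set.Ioo (0:ℝ) 1, arc u v t ∉ Set.range vpos
  inter_finite : ∀ u v w z, G.Adj u v → G.Adj w z → s(u, v) ≠ s(w, z) →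
    ((arc u v '' Set.Icc 0 1) ∩ (arc w z '' Set.Icc 0 1)).Finite
  no_triple_point : ∀ p : ℝ × ℝ, p ∉ Set.range vpos →
    ∀ u₁ v₁ u₂ v₂ u₃ v₃, G.Adj u₁ v₁ → G.Adj u₂ v₂ → G.Adj u₃ v₃ →
      s(u₁, v₁) ≠ s(u₂, v₂) → s(u₁, v₁) ≠ s(u₃, v₃) → s(u₂, v₂) ≠ s(u₃, v₃) →
      ¬ (p ∈ arc u₁ v₁ '' Set.Icc 0 1 ∧ p ∈ arc u₂ v₂ '' Set.Icc 0 1 ∧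
          p ∈ arc u₃ v₃ '' Set.Icc 0 1)

namespace Drawing

variable {V : Type} {G : SimpleGraph V}

lemma img_symm_aux (Γ : Drawing G) (u v : V) :
    Γ.arc u v '' Set.Icc 0 1 = Γ.arc v u '' Set.Icc 0 1 := by
  have key : ∀ a b : V, Γ.arc a b '' Set.Icc 0 1 ⊆ Γ.arc b a '' Set.Icc 0 1 := by
    rintro a b p ⟨t, ht, rfl⟩
    refine ⟨1 - t, ⟨by linarith [ht.2], by linarith [ht.1]⟩, ?_⟩
    rw [Γ.arc_symm b a (1 - t)]
    congr 1
    ring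
  exact Set.Subset.antisymm (key u v) (key v u)

/-- The image (trace) of an edge in the drawing. -/
def img (Γ : Drawing G) (e : Sym2 V) : Set (ℝ × ℝ) :=
  Sym2.lift ⟨fun u v => Γ.arc u v '' Set.Icc 0 1, fun u v => Γ.img_symm_aux u v⟩ e

/-- `p` is a crossing point of the two distinct edges `e` and `f` : it lies on
both arcs and is not the image of a vertex (so it is not a shared endpoint). -/
def Crossing (Γ : Drawing G) (e f : Sym2 V) (p : ℝ × ℝ) : Prop :=
  e ∈ G.edgeSet ∧ f ∈ G.edgeSet ∧ e ≠ f ∧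
    p ∈ Γ.img e ∧ p ∈ Γ.img f ∧ p ∉ Set.range Γ.vpos

/-- The edges `e` and `f` cross in the drawing. -/
def Crosses (Γ : Drawing G) (e f : Sym2 V) : Prop := ∃ p, Γ.Crossing e f p

/-- The set of crossing points of a drawing. -/
def crossingSet (Γ : Drawing G) : Set (ℝ × ℝ) := {p | ∃ e f, Γ.Crossing e f p}

/-- The number of crossings of a drawing. -/
def crossings (Γ : Drawing G) : ℕ := Γ.crossingSet.ncard

/-- The set of crossing points lying on a given edge. -/
def edgeCrossings (Γ : Drawing G) (e : Sym2 V) : Set (ℝ × ℝ) :=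
  {p | ∃ f, Γ.Crossing e f p}

/-- A drawing is `k`-planar if every edge is involved in at most `k` crossings. -/
def IsKPlanar (Γ : Drawing G) (k : ℕ) : Prop :=
  ∀ e ∈ G.edgeSet, (Γ.edgeCrossings e).ncard ≤ k

/-- A drawing is `k`-gap-planar if each crossing can be assigned to one of its
two involved edges such that every edge is assigned at most `k` crossings. -/
def IsKGapPlanar (Γ : Drawing G) (k : ℕ) : Prop :=
  ∃ assign : ℝ × ℝ → Sym2 V,
    (∀ p ∈ Γ.crossingSet, ∃ f, Γ.Crossing (assign p) f p) ∧
    ∀ e : Sym2 V, {p | p ∈ Γ.crossingSet ∧ assign p = e}.ncard ≤ k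

/-- A drawing is skewness-`k` if there is a set of at most `k` edges such that
every crossing involves an edge from the set. -/
def IsSkewness (Γ : Drawing G) (k : ℕ) : Prop :=
  ∃ S : Finset (Sym2 V), S.card ≤ k ∧
    ∀ p ∈ Γ.crossingSet, ∃ e ∈ S, ∃ f, Γ.Crossing e f p

/-- A drawing is `k`-apex if there is a set of at most `k` vertices such that
every crossing involves an edge incident to one of these vertices. -/
def IsKApex (Γ : Drawing G) (k : ℕ) : Prop :=
  ∃ S : Finset V, S.card ≤ k ∧
    ∀ p ∈ Γ.crossingSet, ∃ e f, Γ.Crossing e f p ∧ ∃ a ∈ S, a ∈ e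

/-- A drawing is `(k,l)`-grid-free if there is no set of `k` edges each of
which crosses each edge of some set of `l` edges. -/
def IsGridFree (Γ : Drawing G) (k l : ℕ) : Prop :=
  ¬ ∃ A B : Finset (Sym2 V), A.card = k ∧ B.card = l ∧
      ∀ e ∈ A, ∀ f ∈ B, Γ.Crosses e f

/-- A drawing is `k`-fan-crossing-free if no edge crosses `k` edges that all
share a common endpoint. -/
def IsKFanCrossingFree (Γ : Drawing G) (k : ℕ) : Prop :=
  ¬ ∃ (e : Sym2 V) (a : V) (F : Finset (Sym2 V)), F.card = k ∧
      ∀ f ∈ F, a ∈ f ∧ Γ.Crosses e f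

/-- A drawing is planarly connected if for any two crossing edges, two of
their endpoints are joined by a crossing-free edge. -/
def IsPlanarlyConnected (Γ : Drawing G) : Prop :=
  ∀ e f : Sym2 V, Γ.Crosses e f →
    ∃ a b : V, a ∈ e ∧ b ∈ f ∧ G.Adj a b ∧ Γ.edgeCrossings s(a, b) = ∅

/-- A drawing is straight-line if every edge is drawn as the line segment
between the images of its endpoints. -/
def IsStraight (Γ : Drawing G) : Prop :=
  ∀ u v : V, G.Adj u v → ∀ t ∈ Set.Icc (0:ℝ) 1,
    Γ.arc u v t = (1 - t) • Γ.vpos u + t • Γ.vpos v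

/-- A straight-line RAC drawing: straight-line and any two crossing edges are
perpendicular. -/
def IsRAC (Γ : Drawing G) : Prop :=
  Γ.IsStraight ∧
    ∀ u v w z : V, G.Adj u v → G.Adj w z → Γ.Crosses s(u, v) s(w, z) →
      (Γ.vpos v - Γ.vpos u).1 * (Γ.vpos z - Γ.vpos w).1 +
        (Γ.vpos v - Γ.vpos u).2 * (Γ.vpos z - Γ.vpos w).2 = 0

end Drawing

/-- The crossing number of `G`: the minimum number of crossings over all
drawings of `G`. -/
def crNum {V : Type} (G : SimpleGraph V) : ℕ :=
  sInf {n | ∃ Γ : Drawing G, Γ.crossings = n}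

/-- The crossing number of `G` restricted to drawings satisfying `P`. -/
def crNumRestricted {V : Type} (G : SimpleGraph V) (P : Drawing G → Prop) : ℕ :=
  sInf {n | ∃ Γ : Drawing G, P Γ ∧ Γ.crossings = n}

/-- The rectilinear crossing number of `G`. -/
def rectCrNum {V : Type} (G : SimpleGraph V) : ℕ :=
  crNumRestricted G (fun Γ => Γ.IsStraight)

/-- An ℓ₂-bundle between `x` and `y`: `P` is the set of the internal vertices
of ℓ internally disjoint paths of length two from `x` to `y`, all of whose
internal vertices have degree exactly two in `G` (here ℓ = `P.card`). -/
def IsL2Bundle {V : Type} (G : SimpleGraph V) (x y : V) (P : Finset V) : Prop :=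
  x ≠ y ∧ x ∉ P ∧ y ∉ P ∧
    ∀ p ∈ P, G.Adj x p ∧ G.Adj p y ∧ (G.neighborSet p).ncard = 2

/-- Two drawings of `G` are weakly isomorphic: there is an incidence-preserving
one-to-one correspondence of vertices and edges that preserves crossings. -/
def WeaklyIso {V : Type} {G : SimpleGraph V} (Γ Γ' : Drawing G) : Prop :=
  ∃ φ : G ≃g G, ∀ e f : Sym2 V,
    Γ.Crosses e f ↔ Γ'.Crosses (Sym2.map (fun a => φ a) e) (Sym2.map (fun a => φ a) f)

theorem exists_continuous_log {A : Type*} [TopologicalSpace A] [SimplyConnectedSpace A]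
    [LocallyPathConnectedSpace A] {f : A → ℂ} (hf : Continuous f) (h0 : ∀ a, f a ≠ 0) :
    ∃ L : A → ℂ, Continuous L ∧ ∀ a, Complex.exp (L a) = f a := by
  obtain ⟨a₀⟩ : Nonempty A := inferInstance
  obtain ⟨F, ⟨-, hF⟩, -⟩ := Complex.isCoveringMapOn_exp.existsUnique_continuousMap_lifts
    ⟨f, hf⟩ (a₀ := a₀) (e₀ := Complex.log (f a₀)) (Complex.exp_log (h0 a₀)) (fun a => h0 a)
  exact ⟨F, F.continuous, fun a => congrFun hF a⟩

/-- Two logarithms of a nonvanishing function on `ℝ`, up to a constant factor, have the same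
increments. -/
theorem log_increment_unique {l l' : ℝ → ℂ} (hl : Continuous l) (hl' : Continuous l') (c : ℂ)
    (h : ∀ t, Complex.exp (l t) = c * Complex.exp (l' t)) : l 1 - l 0 = l' 1 - l' 0 := by
  have key := Complex.isCoveringMapOn_exp.existsUnique_continuousMap_lifts
    (⟨fun t => Complex.exp (l t), by fun_prop⟩ : C(ℝ, ℂ)) (a₀ := 0) (e₀ := l 0) rfl
    (fun a => Complex.exp_ne_zero _)
  have := key.unique (y₁ := ⟨l, hl⟩) (y₂ := ⟨fun t => l' t + (l 0 - l' 0), by fun_prop⟩)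
    ⟨rfl, rfl⟩ ⟨by simp, by
      funext t
      simp only [ContinuousMap.coe_mk, Function.comp_apply, Complex.exp_add, Complex.exp_sub, h]
      field_simp⟩
  have h1 := congrArg (fun F : C(ℝ, ℂ) => F 1) this
  simp only [ContinuousMap.coe_mk] at h1
  rw [h1]; ring

/-- The variation of the logarithm along a nonvanishing function. -/
theorem exists_log_increment {f : ℝ → ℂ} (hf : Continuous f) (h0 : ∀ t, f t ≠ 0) :
    ∃ w : ℂ, Complex.exp w * f 0 = f 1 ∧ ∀ (c : ℂ) (l : ℝ → ℂ), Continuous l →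
      (∀ t, Complex.exp (l t) = c * f t) → l 1 - l 0 = w := by
  obtain ⟨L, hL, hLf⟩ := exists_continuous_log hf h0
  refine ⟨L 1 - L 0, ?_, fun c l hl h => log_increment_unique hl hL c fun t => by rw [h, hLf]⟩
  rw [Complex.exp_sub, hLf, hLf, div_mul_cancel₀ _ (h0 0)]

theorem exists_int_sub_eq_of_exp_eq {x y : ℂ} (h : Complex.exp x = Complex.exp y) :
    ∃ n : ℤ, x = y + 2 * n * (Real.pi * Complex.I) := by
  obtain ⟨n, hn⟩ := Complex.exp_eq_exp_iff_exists_int.1 h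
  exact ⟨n, by rw [hn]; ring⟩

theorem exists_odd_sub_eq_of_exp_eq_neg {x y : ℂ} (h : Complex.exp x = -Complex.exp y) :
    ∃ n : ℤ, x = y + (2 * n + 1) * (Real.pi * Complex.I) := by
  have h' : Complex.exp x = Complex.exp (y + Real.pi * Complex.I) := by
    rw [h, Complex.exp_add, Complex.exp_pi_mul_I]; ring
  obtain ⟨n, hn⟩ := exists_int_sub_eq_of_exp_eq h'
  exact ⟨n, by rw [hn]; ring⟩

/-- In every continuous map of `K₃,₃` to the plane two independent edges meet. -/
theorem k33_independent_edges_meet (a b : Fin 3 → ℂ) (γ : ∀ i j, Path (a i) (b j)) :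
    ∃ i i' j j' s t, i ≠ i' ∧ j ≠ j' ∧ γ i j s = γ i' j' t := by
  by_contra! H
  have hd : ∀ i i' j j', i ≠ i' → j ≠ j' → ∀ s t : ℝ,
      (γ i j).extend s - (γ i' j').extend t ≠ 0 := fun i i' j j' hi hj s t =>
    sub_ne_zero.2 (H i i' j j' _ _ hi hj)
  have third : ∀ i : Fin 3, ∃ i', i' ≠ i := by decide
  have hda : ∀ i i' j, i ≠ i' → ∀ t : ℝ, (γ i j).extend t - a i' ≠ 0 := by
    intro i i' j hi t
    obtain ⟨j', hj⟩ := third j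
    simpa using hd i i' j j' hi hj.symm t 0
  have hdb : ∀ i j j', j ≠ j' → ∀ t : ℝ, (γ i j).extend t - b j' ≠ 0 := by
    intro i j j' hj t
    obtain ⟨i', hi⟩ := third i
    simpa using hd i i' j j' hi.symm hj t 1
  have haa : ∀ i i', i ≠ i' → a i - a i' ≠ 0 := fun i i' hi => by simpa using hda i i' 0 hi 0
  have hbb : ∀ j j', j ≠ j' → b j - b j' ≠ 0 := fun j j' hj => by simpa using hdb 0 j j' hj 1
  have hba : ∀ i j, b j - a i ≠ 0 := fun i j => by
    obtain ⟨i', hi⟩ := third i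
    simpa using hda i' i j hi 1
  have hX : ∀ i i' j, ∃ w : ℂ, i ≠ i' → Complex.exp w * (a i - a i') = b j - a i' ∧
      ∀ (c : ℂ) (l : ℝ → ℂ), Continuous l →
      (∀ t, Complex.exp (l t) = c * ((γ i j).extend t - a i')) → l 1 - l 0 = w := by
    intro i i' j
    by_cases hi : i = i'
    · exact ⟨0, fun h => absurd hi h⟩
    obtain ⟨w, hw⟩ := exists_log_increment (f := fun t => (γ i j).extend t - a i')
      (by fun_prop) (hda i i' j hi)
    exact ⟨w, fun _ => by simpa using hw⟩
  have hY : ∀ i j j', ∃ w : ℂ, j ≠ j' → Complex.exp w * (a i - b j') = b j - b j' ∧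
      ∀ (c : ℂ) (l : ℝ → ℂ), Continuous l →
      (∀ t, Complex.exp (l t) = c * ((γ i j).extend t - b j')) → l 1 - l 0 = w := by
    intro i j j'
    by_cases hj : j = j'
    · exact ⟨0, fun h => absurd hj h⟩
    obtain ⟨w, hw⟩ := exists_log_increment (f := fun t => (γ i j).extend t - b j')
      (by fun_prop) (hdb i j j' hj)
    exact ⟨w, fun _ => by simpa using hw⟩
  choose x hx using hX
  choose y hy using hY
  have square : ∀ i i' j j', i ≠ i' → j ≠ j' →
      x i i' j + y i' j' j = x i' i j' + y i j j' := by
    intro i i' j j' hi hj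
    obtain ⟨L, hL, hLf⟩ := exists_continuous_log (A := ℝ × ℝ)
      (f := fun z => (γ i j).extend z.1 - (γ i' j').extend z.2) (by fun_prop)
      (fun z => hd i i' j j' hi hj z.1 z.2)
    have e1 := (hx i i' j hi).2 1 (fun s => L (s, 0)) (by fun_prop) (fun t => by simp [hLf])
    have e2 := (hy i' j' j hj.symm).2 (-1) (fun s => L (1, s)) (by fun_prop)
      (fun t => by simp [hLf])
    have e3 := (hx i' i j' hi.symm).2 (-1) (fun s => L (0, s)) (by fun_prop)
      (fun t => by simp [hLf])
    have e4 := (hy i j j' hj).2 1 (fun s => L (s, 1)) (by fun_prop) (fun t => by simp [hLf])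
    rw [← e1, ← e2, ← e3, ← e4]; ring
  have hn : ∀ i i' j, ∃ n : ℤ, i ≠ i' → x i i' j = Complex.log (b j - a i') -
      Complex.log (a i - a i') + 2 * n * (Real.pi * Complex.I) := by
    intro i i' j
    by_cases hi : i = i'
    · exact ⟨0, fun h => absurd hi h⟩
    obtain ⟨n, h⟩ := exists_int_sub_eq_of_exp_eq (x := x i i' j)
      (y := Complex.log (b j - a i') - Complex.log (a i - a i')) (by
        rw [Complex.exp_sub, Complex.exp_log (hba _ _), Complex.exp_log (haa _ _ hi),
          ← (hx i i' j hi).1, mul_div_cancel_right₀ _ (haa _ _ hi)])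
    exact ⟨n, fun _ => h⟩
  have hm : ∀ i j j', ∃ n : ℤ, j ≠ j' → y i j j' = Complex.log (b j - b j') -
      Complex.log (b j' - a i) + (2 * n + 1) * (Real.pi * Complex.I) := by
    intro i j j'
    by_cases hj : j = j'
    · exact ⟨0, fun h => absurd hj h⟩
    obtain ⟨n, h⟩ := exists_odd_sub_eq_of_exp_eq_neg (x := y i j j')
      (y := Complex.log (b j - b j') - Complex.log (b j' - a i)) (by
        rw [Complex.exp_sub, Complex.exp_log (hba _ _), Complex.exp_log (hbb _ _ hj),
          ← (hy i j j' hj).1, ← neg_sub (b j') (a i), mul_neg, neg_div, neg_neg,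
          mul_div_cancel_right₀ _ (hba _ _)])
    exact ⟨n, fun _ => h⟩
  have odd : ∀ z w : ℂ, z - w ≠ 0 → ∃ n : ℤ, Complex.log (z - w) =
      Complex.log (w - z) + (2 * n + 1) * (Real.pi * Complex.I) := by
    intro z w h
    have h' : w - z ≠ 0 := by rw [← neg_sub]; exact neg_ne_zero.2 h
    exact exists_odd_sub_eq_of_exp_eq_neg (by rw [Complex.exp_log h, Complex.exp_log h', neg_sub])
  choose n hn using hn
  choose m hm using hm
  have hpi : (Real.pi * Complex.I : ℂ) ≠ 0 :=
    mul_ne_zero (by exact_mod_cast Real.pi_ne_zero) Complex.I_ne_zero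
  obtain ⟨α, hα⟩ : ∃ α : Fin 3 → Fin 3 → ℤ, ∀ i i', i ≠ i' → Complex.log (a i - a i') =
      Complex.log (a i' - a i) + (2 * α i i' + 1) * (Real.pi * Complex.I) := by
    have : ∀ i i', ∃ n : ℤ, i ≠ i' → Complex.log (a i - a i') =
      Complex.log (a i' - a i) + (2 * n + 1) * (Real.pi * Complex.I) := by
      intro i i'
      by_cases hi : i = i'
      · exact ⟨0, fun h => absurd hi h⟩
      exact (odd _ _ (haa i i' hi)).imp fun n h _ => h
    choose α hα using this
    exact ⟨α, hα⟩
  have pair : ∀ i i' j j', i ≠ i' → j ≠ j' →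
      n i i' j + n i i' j' + m i' j' j + m i' j j' - (2 * α i i' + 1) = 
      n i' i j' + n i' i j + m i j j' + m i j' j := by
    intro i i' j j' hi hj
    have s1 := square i i' j j' hi hj
    have s2 := square i i' j' j hi hj.symm
    rw [hn _ _ _ hi, hn _ _ _ hi.symm, hm _ _ _ hj, hm _ _ _ hj.symm] at s1 s2
    have h3 := hα i i' hi
    have : (2 * (n i i' j + n i i' j' + m i' j' j + m i' j j' - (2 * α i i' + 1) -
      (n i' i j' + n i' i j + m i j j' + m i j' j)) : ℂ) * (Real.pi * Complex.I) = 0 := by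
      linear_combination s1 + s2 + 2 * h3
    have h4 := (mul_eq_zero.1 this).resolve_right hpi
    have h5 : (2 * (n i i' j + n i i' j' + m i' j' j + m i' j j' - (2 * α i i' + 1) -
      (n i' i j' + n i' i j + m i j j' + m i j' j)) : ℤ) = 0 := by exact_mod_cast h4
    omega
  have p1 := pair 0 1 0 1 (by decide) (by decide)
  have p2 := pair 0 1 0 2 (by decide) (by decide)
  have p3 := pair 0 1 1 2 (by decide) (by decide)
  have p4 := pair 0 2 0 1 (by decide) (by decide)
  have p5 := pair 0 2 0 2 (by decide) (by decide)
  have p6 := pair 0 2 1 2 (by decide) (by decide)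
  have p7 := pair 1 2 0 1 (by decide) (by decide)
  have p8 := pair 1 2 0 2 (by decide) (by decide)
  have p9 := pair 1 2 1 2 (by decide) (by decide)
  omega

namespace Drawing

variable {V : Type} {G : SimpleGraph V}

theorem vpos_mem_img_iff (Γ : Drawing G) {e : Sym2 V} (he : e ∈ G.edgeSet) {z : V} :
    Γ.vpos z ∈ Γ.img e ↔ z ∈ e := by
  induction e using Sym2.ind with | _ u v
  have h : G.Adj u v := he
  constructor
  · rintro ⟨t, ht, hz⟩
    rcases ht.1.eq_or_lt with rfl | h0
    · rw [Γ.arc_start u v h] at hz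
      simp [Γ.vpos_inj hz]
    rcases ht.2.eq_or_lt with rfl | h1
    · rw [Γ.arc_end u v h] at hz
      simp [Γ.vpos_inj hz]
    · exact absurd ⟨z, hz.symm⟩ (Γ.arc_avoids u v h t ⟨h0, h1⟩)
  · intro hz
    rcases Sym2.mem_iff.1 hz with rfl | rfl
    · exact ⟨0, by simp, Γ.arc_start _ _ h⟩
    · exact ⟨1, by simp, Γ.arc_end _ _ h⟩

/-- The arc of an edge as a path. -/
theorem exists_path_of_adj (Γ : Drawing G) {u v : V} (h : G.Adj u v) :
    ∃ γ : Path (Γ.vpos u) (Γ.vpos v), ∀ t, γ t ∈ Γ.img s(u, v) :=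
  ⟨{ toFun := fun t => Γ.arc u v t
     continuous_toFun := continuousOn_iff_continuous_domRestrict.1 (Γ.arc_cont u v h)
     source' := Γ.arc_start u v h
     target' := Γ.arc_end u v h }, fun t => ⟨t, t.2, rfl⟩⟩

theorem exists_path_of_walk (Γ : Drawing G) {u v w : V} (h : G.Adj u v) (p : G.Walk v w) :
    ∃ γ : Path (Γ.vpos u) (Γ.vpos w), ∀ t, ∃ e ∈ (p.cons h).edges, γ t ∈ Γ.img e := by
  induction p generalizing u with
  | nil =>
    obtain ⟨γ, hγ⟩ := Γ.exists_path_of_adj h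
    exact ⟨γ, fun t => ⟨_, by simp, hγ t⟩⟩
  | cons h' p ih =>
    obtain ⟨γ, hγ⟩ := Γ.exists_path_of_adj h
    obtain ⟨δ, hδ⟩ := ih h'
    refine ⟨γ.trans δ, fun t => ?_⟩
    have ht : γ.trans δ t ∈ Set.range (γ.trans δ) := ⟨t, rfl⟩
    rw [Path.trans_range] at ht
    rcases ht with ⟨s, hs⟩ | ⟨s, hs⟩
    · exact ⟨_, by simp, hs ▸ hγ s⟩
    · obtain ⟨e, he, hx⟩ := hδ s
      exact ⟨e, by rw [SimpleGraph.Walk.edges_cons]; exact List.mem_cons_of_mem _ he, hs ▸ hx⟩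

theorem exists_crossing_of_walks (Γ : Drawing G) (a b : Fin 3 → V) (w : ∀ i j, G.Walk (a i) (b j))
    (hab : ∀ i j, a i ≠ b j)
    (hw : ∀ i i' j j', i ≠ i' → j ≠ j' → (w i j).support.Disjoint (w i' j').support) :
    ∃ i i' j j', i ≠ i' ∧ j ≠ j' ∧ ∃ e ∈ (w i j).edges, ∃ f ∈ (w i' j').edges, Γ.Crosses e f := by
  have hpath : ∀ i j, ∃ γ : Path (Γ.vpos (a i)) (Γ.vpos (b j)),
      ∀ t, ∃ e ∈ (w i j).edges, γ t ∈ Γ.img e := by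
    have aux : ∀ {u v : V} (p : G.Walk u v), u ≠ v → ∃ γ : Path (Γ.vpos u) (Γ.vpos v),
        ∀ t, ∃ e ∈ p.edges, γ t ∈ Γ.img e := by
      intro u v p huv
      cases p with
      | nil => exact absurd rfl huv
      | cons h q => exact Γ.exists_path_of_walk h q
    exact fun i j => aux (w i j) (hab i j)
  choose γ hγ using hpath
  have hc : Continuous Complex.equivRealProdCLM.symm := Complex.equivRealProdCLM.symm.continuous
  obtain ⟨i, i', j, j', s, t, hi, hj, hst⟩ := k33_independent_edges_meet _ _
    (fun i j => (γ i j).map hc)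
  have hst' : γ i j s = γ i' j' t := Complex.equivRealProdCLM.symm.injective hst
  obtain ⟨e, he, hxe⟩ := hγ i j s
  obtain ⟨f, hf, hxf⟩ := hγ i' j' t
  have heG := SimpleGraph.Walk.edges_subset_edgeSet _ he
  have hfG := SimpleGraph.Walk.edges_subset_edgeSet _ hf
  have hdisj : ∀ z, z ∈ e → z ∈ f → False := fun z hz hz' =>
    hw i i' j j' hi hj (SimpleGraph.Walk.mem_support_of_mem_edges he hz)
      (SimpleGraph.Walk.mem_support_of_mem_edges hf hz')
  refine ⟨i, i', j, j', hi, hj, e, he, f, hf, γ i j s, heG, hfG, ?_, hxe, hst' ▸ hxf, ?_⟩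
  · rintro rfl
    exact hdisj _ (Sym2.out_fst_mem e) (Sym2.out_fst_mem e)
  · rintro ⟨z, hz⟩
    rw [← hz] at hxe
    rw [← hst', ← hz] at hxf
    exact hdisj z ((Γ.vpos_mem_img_iff heG).1 hxe) ((Γ.vpos_mem_img_iff hfG).1 hxf)

/-- No three distinct edges pass through a crossing. -/
theorem Crossing.eq_or_eq {Γ : Drawing G} {e f g : Sym2 V} {x : ℝ × ℝ} (h : Γ.Crossing e f x)
    (hg : g ∈ G.edgeSet) (hx : x ∈ Γ.img g) : g = e ∨ g = f := by
  obtain ⟨he, hf, hef, hxe, hxf, hv⟩ := h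
  by_contra! hne
  induction e using Sym2.ind with | _ u₁ v₁
  induction f using Sym2.ind with | _ u₂ v₂
  induction g using Sym2.ind with | _ u₃ v₃
  exact Γ.no_triple_point x hv u₁ v₁ u₂ v₂ u₃ v₃ he hf hg hef hne.1.symm hne.2.symm ⟨hxe, hxf, hx⟩

theorem crossingSet_finite [Finite V] (Γ : Drawing G) : Γ.crossingSet.Finite := by
  have : Finite (Sym2 V × Sym2 V) := inferInstance
  refine (Set.finite_iUnion (ι := {q : Sym2 V × Sym2 V //
    q.1 ∈ G.edgeSet ∧ q.2 ∈ G.edgeSet ∧ q.1 ≠ q.2})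
    (f := fun q => Γ.img q.1.1 ∩ Γ.img q.1.2) ?_).subset ?_
  · rintro ⟨⟨e, f⟩, he, hf, hne⟩
    induction e using Sym2.ind with | _ u v
    induction f using Sym2.ind with | _ w z
    exact Γ.inter_finite u v w z he hf hne
  · rintro x ⟨e, f, he, hf, hne, hxe, hxf, -⟩
    exact Set.mem_iUnion.2 ⟨⟨⟨e, f⟩, he, hf, hne⟩, hxe, hxf⟩

end Drawing

/-- The vertices of the gadget: the corners of a hexagon, `ℓ` internal vertices of a bundle of
paths of length two for each of its sides, and two hubs. -/
inductive Node (ℓ : ℕ)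
  | corner (i : Fin 6)
  | mid (i : Fin 6) (j : Fin ℓ)
  | hub (b : Bool)

/-- The edges of the gadget: the two halves of each path of a bundle, the spokes joining the hubs
to the corners of one parity, and the bridge between the hubs. -/
inductive Link (ℓ : ℕ)
  | half (i : Fin 6) (j : Fin ℓ) (b : Bool)
  | spoke (i : Fin 6)
  | bridge

variable {k ℓ : ℕ} {V : Type}

namespace Link

def fst : Link ℓ → Node ℓ
  | half i _ b => .corner (if b then i + 1 else i)
  | spoke i => .hub (i.val % 2 == 1)
  | bridge => .hub false

def snd : Link ℓ → Node ℓ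
  | half i j _ => .mid i j
  | spoke i => .corner i
  | bridge => .hub true

/-- The end vertices of an edge of the gadget. -/
def ends (e : Link ℓ) : Sym2 (Node ℓ) := s(e.fst, e.snd)

theorem fst_ne_snd (e : Link ℓ) : e.fst ≠ e.snd := by
  cases e <;> simp [fst, snd]

theorem ends_injective : Function.Injective (ends (ℓ := ℓ)) := by
  intro e e' h
  rcases e with ⟨i, j, b⟩ | ⟨i⟩ | _ <;> rcases e' with ⟨i', j', b'⟩ | ⟨i'⟩ | _ <;>
    simp [ends, fst, snd] at h ⊢
  · obtain ⟨h, rfl, rfl⟩ := h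
    cases b <;> cases b' <;> simp at h ⊢
  · exact h.2

end Link

/-- The edge of a copy of the gadget. -/
def copyEdge (ι : Fin k × Node ℓ → V) (s : Fin k × Link ℓ) : Sym2 V :=
  s.2.ends.map fun x => ι (s.1, x)

theorem copyEdge_injective {ι : Fin k × Node ℓ → V} (hι : Function.Injective ι) :
    Function.Injective (copyEdge ι) := by
  rintro ⟨j, e⟩ ⟨j', e'⟩ h
  have h1 : ι (j, e.fst) ∈ copyEdge ι (j', e') := by
    rw [← h]; exact Sym2.mem_mk_left _ _
  obtain rfl : j = j' := by
    rcases Sym2.mem_iff.1 h1 with h1 | h1 <;> exact congrArg Prod.fst (hι h1)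
  have : e.ends = e'.ends := Sym2.map.injective (fun x y hxy => congrArg Prod.snd (hι hxy)) h
  rw [Link.ends_injective this]

/-- `HasWalk G ι x y N L`: the images under `ι` of the nodes `N` and links `L` are
the vertices and the edges of a walk of `G`. -/
def HasWalk (G : SimpleGraph V) (ι : Node ℓ → V) (x y : Node ℓ) (N : List (Node ℓ))
    (L : List (Link ℓ)) : Prop :=
  ∃ w : G.Walk (ι x) (ι y), w.support = N.map ι ∧ w.edges = L.map fun e => e.ends.map ι

theorem HasWalk.nil (G : SimpleGraph V) (ι : Node ℓ → V) (x : Node ℓ) :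
    HasWalk G ι x x [x] [] := ⟨.nil, rfl, rfl⟩

theorem HasWalk.cons {G : SimpleGraph V} {ι : Node ℓ → V}
    (hG : ∀ e : Link ℓ, e.ends.map ι ∈ G.edgeSet) {x y z : Node ℓ} {N L} (e : Link ℓ)
    (h : HasWalk G ι y z N L) (he : e.ends = s(x, y)) : HasWalk G ι x z (x :: N) (e :: L) := by
  obtain ⟨w, h1, h2⟩ := h
  have hxy : G.Adj (ι x) (ι y) := by simpa [he] using hG e
  exact ⟨.cons hxy w, by simp [SimpleGraph.Walk.support_cons, h1],
    by simp [SimpleGraph.Walk.edges_cons, h2, he]⟩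

/-- The links of a subdivision of `K₃,₃` in the gadget. -/
def Link.Kept (l : Fin ℓ) : Link ℓ → Prop
  | half _ j _ => j = l
  | spoke i => i ≠ 4 ∧ i ≠ 5
  | bridge => True

theorem exists_crosses_kept {G : SimpleGraph V} (Γ : Drawing G) {ι : Node ℓ → V}
    (hι : Function.Injective ι) (hG : ∀ e : Link ℓ, e.ends.map ι ∈ G.edgeSet) (l : Fin ℓ) :
    ∃ e f : Link ℓ, Γ.Crosses (e.ends.map ι) (f.ends.map ι) ∧ e.Kept l ∧ f.Kept l ∧
      (e = .bridge → ∃ i b, f = .half i l b) ∧ (f = .bridge → ∃ i b, e = .half i l b) := by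
  let A : Fin 3 → Node ℓ := ![.hub false, .corner 1, .corner 3]
  let B : Fin 3 → Node ℓ := ![.hub true, .corner 0, .corner 2]
  let N : Fin 3 → Fin 3 → List (Node ℓ) := ![
    ![[.hub false, .hub true], [.hub false, .corner 0], [.hub false, .corner 2]],
    ![[.corner 1, .hub true], [.corner 1, .mid 0 l, .corner 0], [.corner 1, .mid 1 l, .corner 2]],
    ![[.corner 3, .hub true], [.corner 3, .mid 3 l, .corner 4, .mid 4 l, .corner 5, .mid 5 l,
      .corner 0], [.corner 3, .mid 2 l, .corner 2]]]
  let L : Fin 3 → Fin 3 → List (Link ℓ) := ![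
    ![[.bridge], [.spoke 0], [.spoke 2]],
    ![[.spoke 1], [.half 0 l true, .half 0 l false], [.half 1 l false, .half 1 l true]],
    ![[.spoke 3], [.half 3 l false, .half 3 l true, .half 4 l false, .half 4 l true,
      .half 5 l false, .half 5 l true], [.half 2 l true, .half 2 l false]]]
  have hW : ∀ i j, HasWalk G ι (A i) (B j) (N i j) (L i j) := by
    intro i j
    fin_cases i <;> fin_cases j <;>
      repeat' first
        | exact HasWalk.nil _ _ _
        | refine HasWalk.cons hG _ ?_ rfl
        | refine HasWalk.cons hG _ ?_ Sym2.eq_swap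
  choose w hN hL using hW
  obtain ⟨i, i', j, j', hi, hj, e, he, f, hf, hef⟩ := Γ.exists_crossing_of_walks _ _ w
    (by
      intro i j h
      have := hι h
      fin_cases i <;> fin_cases j <;> simp [A, B] at this)
    (by
      intro i i' j j' hi hj
      rw [hN, hN]
      refine List.disjoint_map hι ?_
      fin_cases i <;> fin_cases i' <;> first
        | exact absurd rfl hi
        | fin_cases j <;> fin_cases j' <;> first
          | exact absurd rfl hj
          | simp [N])
  rw [hL, List.mem_map] at he hf
  obtain ⟨e, he, rfl⟩ := he
  obtain ⟨f, hf, rfl⟩ := hf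
  have kept : ∀ i j, ∀ e ∈ L i j, e.Kept l := by
    intro i j
    fin_cases i <;> fin_cases j <;> simp [L, Link.Kept]
  have indep : ∀ i i' j j', i ≠ i' → j ≠ j' → ∀ e ∈ L i j, ∀ f ∈ L i' j', e = .bridge →
      ∃ i b, f = .half i l b := by
    intro i i' j j' hi hj
    fin_cases i <;> fin_cases j <;> simp [L]
    fin_cases i' <;> fin_cases j' <;> simp at hi hj ⊢
  exact ⟨e, f, hef, kept _ _ _ he, kept _ _ _ hf, indep _ _ _ _ hi hj _ he _ hf,
    indep _ _ _ _ hi.symm hj.symm _ hf _ he⟩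

namespace Node

/-- Rotation of the hexagon by an even number of corners. -/
def rotate (r : Fin 3) : Node ℓ → Node ℓ
  | corner i => corner (i + ⟨2 * r, by omega⟩)
  | mid i j => mid (i + ⟨2 * r, by omega⟩) j
  | hub b => hub b

theorem rotate_injective (r : Fin 3) : Function.Injective (rotate (ℓ := ℓ) r) := by
  intro x y h
  cases x <;> cases y <;> simp_all [rotate]

end Node

/-- Rotation of the hexagon by an even number of corners. -/
def Link.rotate (r : Fin 3) : Link ℓ → Link ℓ
  | half i j b => half (i + ⟨2 * r, by omega⟩) j b
  | spoke i => spoke (i + ⟨2 * r, by omega⟩)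
  | bridge => bridge

theorem Link.ends_rotate (r : Fin 3) (e : Link ℓ) :
    (e.rotate r).ends = e.ends.map (Node.rotate r) := by
  rcases e with ⟨i, j, b⟩ | ⟨i⟩ | _
  · cases b <;> simp [ends, fst, snd, Link.rotate, Node.rotate, add_right_comm]
  · have : ∀ (i : Fin 6) (r : Fin 3), ((i + ⟨2 * r, by omega⟩ : Fin 6).val % 2 == 1) =
      (i.val % 2 == 1) := by decide
    simp only [ends, fst, snd, Link.rotate, Node.rotate, Sym2.map_mk, this]
  · rfl

theorem exists_rotation_ne : ∀ i : Fin 6, ∃ r : Fin 3, ∀ i' : Fin 6, i' ≠ 4 ∧ i' ≠ 5 →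
    i' + ⟨2 * r, by omega⟩ ≠ i := by
  decide

/-- A link that belongs to all subdivisions of `K₃,₃` is the bridge. -/
theorem Link.eq_bridge (hℓ : 2 ≤ ℓ) {e : Link ℓ}
    (h : ∀ r l, ∃ e' : Link ℓ, e'.Kept l ∧ e'.rotate r = e) : e = .bridge := by
  rcases e with ⟨i, j, b⟩ | ⟨i⟩ | _
  · obtain ⟨l, hl⟩ : ∃ l : Fin ℓ, l ≠ j := by
      have : Nontrivial (Fin ℓ) := Fin.nontrivial_iff_two_le.2 hℓ
      exact exists_ne j
    obtain ⟨e', hk, he⟩ := h 0 l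
    cases e' <;> simp_all [Kept, Link.rotate]
  · obtain ⟨r, hr⟩ := exists_rotation_ne i
    obtain ⟨e', hk, he⟩ := h r ⟨0, by omega⟩
    cases e' <;> simp_all [Kept, Link.rotate]
  · rfl

theorem le_crossings_of_isSkewness [Finite V] {G : SimpleGraph V} (Γ : Drawing G)
    {ι : Fin k × Node ℓ → V} (hι : Function.Injective ι) (hG : ∀ s, copyEdge ι s ∈ G.edgeSet)
    (hℓ : 2 ≤ ℓ) (hΓ : Γ.IsSkewness k) : ℓ * k ≤ Γ.crossings := by
  obtain ⟨S, hS, hcov⟩ := hΓ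
  have hinj := copyEdge_injective hι
  have hsub : ∀ (c : Fin k) (r : Fin 3) (l : Fin ℓ), ∃ e f : Link ℓ,
      Γ.Crosses (copyEdge ι (c, e.rotate r)) (copyEdge ι (c, f.rotate r)) ∧ e.Kept l ∧ f.Kept l ∧
      (e = .bridge → ∃ i b, f = .half i l b) ∧ (f = .bridge → ∃ i b, e = .half i l b) := by
    intro c r l
    have heq : ∀ e : Link ℓ, e.ends.map (fun x => ι (c, x.rotate r)) =
        copyEdge ι (c, e.rotate r) := fun e => by
      simp only [copyEdge, Link.ends_rotate, Sym2.map_map]; rfl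
    have := exists_crosses_kept Γ (ι := fun x => ι (c, x.rotate r))
      (fun x y h => Node.rotate_injective r (congrArg Prod.snd (hι h)))
      (fun e => heq e ▸ hG _) l
    simpa only [heq] using this
  have hmem : ∀ c r l, ∃ e : Link ℓ, e.Kept l ∧ copyEdge ι (c, e.rotate r) ∈ S := by
    intro c r l
    obtain ⟨e, f, ⟨x, hx⟩, he, hf, -⟩ := hsub c r l
    obtain ⟨g, hg, g', hgx⟩ := hcov x ⟨_, _, hx⟩
    rcases hx.eq_or_eq hgx.1 hgx.2.2.2.1 with rfl | rfl
    exacts [⟨e, he, hg⟩, ⟨f, hf, hg⟩]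
  have hex : ∀ c, ∃ e : Link ℓ, copyEdge ι (c, e) ∈ S := fun c =>
    let ⟨e, _, he⟩ := hmem c 0 ⟨0, by omega⟩
    ⟨_, he⟩
  choose s hs using hex
  have hSs : ∀ g ∈ S, ∃ c, copyEdge ι (c, s c) = g := by
    classical
    have hcard : S = Finset.univ.image fun c => copyEdge ι (c, s c) := by
      refine (Finset.eq_of_subset_of_card_le ?_ ?_).symm
      · intro g hg
        obtain ⟨c, -, rfl⟩ := Finset.mem_image.1 hg
        exact hs c
      · have hs' : Function.Injective fun c => copyEdge ι (c, s c) :=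
          fun c c' h => congrArg Prod.fst (hinj h)
        simpa [Finset.card_image_of_injective _ hs'] using hS
    intro g hg
    rw [hcard] at hg
    obtain ⟨c, -, hc⟩ := Finset.mem_image.1 hg
    exact ⟨c, hc⟩
  have hbridge : ∀ c, s c = .bridge := fun c => Link.eq_bridge hℓ fun r l => by
    obtain ⟨e, he, heS⟩ := hmem c r l
    obtain ⟨c', hc'⟩ := hSs _ heS
    obtain ⟨rfl, h⟩ := Prod.mk.inj (hinj hc')
    exact ⟨e, he, h.symm⟩
  have hpoint : ∀ c l, ∃ x i b, Γ.Crossing (copyEdge ι (c, .bridge))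
      (copyEdge ι (c, .half i l b)) x := by
    intro c l
    obtain ⟨e, f, ⟨x, hx⟩, -, -, he, hf⟩ := hsub c 0 l
    obtain ⟨g, hg, g', hgx⟩ := hcov x ⟨_, _, hx⟩
    obtain ⟨c', rfl⟩ := hSs g hg
    have hrot : ∀ e : Link ℓ, e.rotate 0 = .bridge → e = .bridge := by
      intro e h
      cases e <;> simp_all [Link.rotate]
    rcases hx.eq_or_eq hgx.1 hgx.2.2.2.1 with h | h
    · obtain ⟨rfl, h'⟩ := Prod.mk.inj (hinj h)
      obtain ⟨i, b, rfl⟩ := he (hrot e (by rw [← h', hbridge]))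
      rw [← h', hbridge] at hx
      exact ⟨x, _, _, hx⟩
    · obtain ⟨rfl, h'⟩ := Prod.mk.inj (hinj h)
      obtain ⟨i, b, rfl⟩ := hf (hrot f (by rw [← h', hbridge]))
      rw [← h', hbridge] at hx
      exact ⟨x, _, _, hx.2.1, hx.1, hx.2.2.1.symm, hx.2.2.2.2.1, hx.2.2.2.1, hx.2.2.2.2.2⟩
  choose x i b hx using hpoint
  have hxinj : Function.Injective fun q : Fin k × Fin ℓ => x q.1 q.2 := by
    rintro ⟨c, l⟩ ⟨c', l'⟩ h
    have hx' := hx c' l'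
    rw [← show x c l = x c' l' from h] at hx'
    rcases (hx c l).eq_or_eq hx'.2.1 hx'.2.2.2.2.1 with h | h
    · simpa using hinj h
    · have h := hinj h
      simp only [Prod.mk.injEq, Link.half.injEq] at h
      exact Prod.ext h.1.symm h.2.2.1.symm
  calc ℓ * k = (Set.range fun q : Fin k × Fin ℓ => x q.1 q.2).ncard := by
        rw [← Set.image_univ, Set.ncard_image_of_injective _ hxinj, Set.ncard_univ]
        simp [mul_comm]
    _ ≤ Γ.crossings := Set.ncard_le_ncard (by
        rintro _ ⟨q, rfl⟩
        exact ⟨_, _, hx q.1 q.2⟩) Γ.crossingSet_finite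

/-- A point of the side `i` of the hexagon, displaced outwards by `τ`. -/
def sidePoint (i : Fin 6) (s τ : ℝ) : ℝ × ℝ :=
  match i with
  | 0 => (-2 * s - τ, -8 + 8 * s)
  | 1 => (-2 + s, τ)
  | 2 => (-1 + s, τ)
  | 3 => (s, τ)
  | 4 => (1 + s, τ)
  | 5 => (2 - 2 * s + τ, -8 * s)

theorem sidePoint_succ (i : Fin 6) : sidePoint (i + 1) 0 0 = sidePoint i 1 0 := by
  fin_cases i <;> simp [sidePoint] <;> norm_num

theorem sidePoint_convex (i : Fin 6) {a b : ℝ} (h : a + b = 1) (s τ s' τ' : ℝ) :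
    a • sidePoint i s τ + b • sidePoint i s' τ' =
      sidePoint i (a * s + b * s') (a * τ + b * τ') := by
  obtain rfl : a = 1 - b := by linarith
  fin_cases i <;> ext <;> simp [sidePoint] <;> ring

/-- The displacement of the middle vertex of a path of a bundle. -/
def height (j : Fin ℓ) : ℝ := 1 / ((j.val : ℝ) + 4)

theorem height_pos (j : Fin ℓ) : 0 < height j := by
  unfold height; positivity

theorem height_le (j : Fin ℓ) : height j ≤ 1 / 4 :=
  one_div_le_one_div_of_le (by norm_num) (by linarith [Nat.cast_nonneg (α := ℝ) j.val])

theorem height_injective : Function.Injective (height (ℓ := ℓ)) := by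
  intro i j h
  have := inv_injective (by simpa [height] using h : ((i.val : ℝ) + 4)⁻¹ = ((j.val : ℝ) + 4)⁻¹)
  exact Fin.ext (by exact_mod_cast add_right_cancel this)

/-- The positions of the vertices of the gadget, with the second hub placed at `q`. -/
def Node.pos (q : ℝ × ℝ) : Node ℓ → ℝ × ℝ
  | corner i => sidePoint i 0 0
  | mid i j => sidePoint i (1 / 2) (height j)
  | hub false => (0, -2)
  | hub true => q

/-- The open segment representing an edge of the gadget. -/
def Link.trace (q : ℝ × ℝ) (e : Link ℓ) : Set (ℝ × ℝ) :=
  openSegment ℝ (e.fst.pos q) (e.snd.pos q)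

/-- The regions of the plane that contain the vertices and the edges of the gadget. -/
inductive Cell
  | corner (i : Fin 6)
  | side (i : Fin 6)
  | spoke (i : Fin 6)
  | hub (b : Bool)
  | bridge

/-- The cell containing a vertex. -/
def Node.cell : Node ℓ → Cell
  | corner i => .corner i
  | mid i _ => .side i
  | hub b => .hub b

/-- The cell containing an edge. -/
def Link.cell : Link ℓ → Cell
  | half i _ _ => .side i
  | spoke i => .spoke i
  | bridge => .bridge

/-- The points of a cell, parametrized by a triangle. -/
def Cell.point (q : ℝ × ℝ) (s τ : ℝ) : Cell → ℝ × ℝ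
  | corner i => sidePoint i 0 0
  | side i => sidePoint i s τ
  | spoke i => (1 - s) • (if i.val % 2 = 1 then q else (0, -2)) + s • sidePoint i 0 0
  | hub false => (0, -2)
  | hub true => q
  | bridge => (1 - s) • (0, -2) + s • q

/-- `x` lies in the cell `c`. -/
def Cell.Contains (q x : ℝ × ℝ) (c : Cell) : Prop :=
  ∃ s τ : ℝ, (0 < s ∧ s < 1 ∧ 0 < τ ∧ 2 * τ ≤ s ∧ 2 * τ ≤ 1 - s) ∧ x = c.point q s τ

theorem mem_openSegment_iff {x y z : ℝ × ℝ} :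
    z ∈ openSegment ℝ x y ↔ ∃ t : ℝ, (0 < t ∧ t < 1) ∧ z = (1 - t) • x + t • y := by
  rw [openSegment_eq_image]
  exact ⟨fun ⟨t, ht, h⟩ => ⟨t, ht, h.symm⟩, fun ⟨t, ht, h⟩ => ⟨t, ht, h.symm⟩⟩

/-- The coordinates along the side of a point on half of a path of a bundle. -/
theorem Link.mem_trace_half {q x : ℝ × ℝ} {i : Fin 6} {j : Fin ℓ} {b : Bool} :
    x ∈ (half i j b).trace q ↔ ∃ t : ℝ, (0 < t ∧ t < 1) ∧
      x = sidePoint i (if b then 1 - t / 2 else t / 2) (t * height j) := by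
  rw [trace, mem_openSegment_iff]
  refine exists_congr fun t => and_congr_right fun _ => ?_
  cases b
  · simp only [fst, snd, Node.pos, Bool.false_eq_true, if_false]
    rw [sidePoint_convex i (by ring)]
    ring_nf
  · simp only [fst, snd, Node.pos, if_true]
    rw [sidePoint_succ, sidePoint_convex i (by ring)]
    ring_nf

theorem Node.cell_contains (q : ℝ × ℝ) (v : Node ℓ) : v.cell.Contains q (v.pos q) := by
  obtain ⟨τ, h0, h1, h⟩ : ∃ τ, 0 < τ ∧ τ ≤ 1 / 4 ∧ v.pos q = v.cell.point q (1 / 2) τ := by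
    rcases v with i | ⟨i, j⟩ | _ | _
    · exact ⟨1 / 4, by norm_num, by norm_num, rfl⟩
    · exact ⟨_, height_pos j, height_le j, rfl⟩
    · exact ⟨1 / 4, by norm_num, by norm_num, rfl⟩
    · exact ⟨1 / 4, by norm_num, by norm_num, rfl⟩
  exact ⟨_, _, ⟨by norm_num, by norm_num, h0, by linarith, by linarith⟩, h⟩

theorem Link.cell_contains {q x : ℝ × ℝ} {e : Link ℓ} (h : x ∈ e.trace q) :
    e.cell.Contains q x := by
  have key : ∀ t : ℝ, 0 < t ∧ t < 1 → 0 < t * (1 - t) / 2 ∧ 2 * (t * (1 - t) / 2) ≤ t ∧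
      2 * (t * (1 - t) / 2) ≤ 1 - t := fun t ht =>
    ⟨by have := mul_pos ht.1 (sub_pos.2 ht.2); linarith, by nlinarith, by nlinarith⟩
  rcases e with ⟨i, j, b⟩ | i | _
  · obtain ⟨t, ht, rfl⟩ := mem_trace_half.1 h
    have h1 := mul_le_mul_of_nonneg_left (height_le j) ht.1.le
    have h2 := mul_pos ht.1 (height_pos j)
    refine ⟨_, _, ?_, rfl⟩
    cases b <;> simp <;> refine ⟨?_, ?_, ?_, ?_, ?_⟩ <;> linarith
  · obtain ⟨t, ht, rfl⟩ := mem_openSegment_iff.1 h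
    refine ⟨t, _, ⟨ht.1, ht.2, key t ht⟩, ?_⟩
    fin_cases i <;> rfl
  · obtain ⟨t, ht, rfl⟩ := mem_openSegment_iff.1 h
    exact ⟨t, _, ⟨ht.1, ht.2, key t ht⟩, rfl⟩

set_option maxHeartbeats 4000000 in
theorem Cell.eq_of_contains_inside {x : ℝ × ℝ} {a b : Cell} (ha : a.Contains (0, -1) x)
    (hb : b.Contains (0, -1) x) :
    a = b ∨ (a = spoke 1 ∧ b = spoke 2) ∨ (a = spoke 2 ∧ b = spoke 1) ∨
      (a = spoke 4 ∧ b = spoke 5) ∨ (a = spoke 5 ∧ b = spoke 4) := by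
  obtain ⟨s, τ, ⟨hs₀, hs₁, hτ₀, hτ₁, hτ₂⟩, ha⟩ := ha
  obtain ⟨s', τ', ⟨hs'₀, hs'₁, hτ'₀, hτ'₁, hτ'₂⟩, hb⟩ := hb
  rw [ha, Prod.ext_iff] at hb
  clear ha
  obtain ⟨h₁, h₂⟩ := hb
  have key : ∀ i : Fin 6, i = 0 ∨ i = 1 ∨ i = 2 ∨ i = 3 ∨ i = 4 ∨ i = 5 := by decide
  rcases a with i | i | i | (_ | _) | _ <;>
    (try obtain rfl | rfl | rfl | rfl | rfl | rfl := key i) <;>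
    rcases b with i | i | i | (_ | _) | _ <;>
      (try obtain rfl | rfl | rfl | rfl | rfl | rfl := key i) <;> first
      | exact Or.inl rfl
      | (right; simp; done)
      | (exfalso; simp [Cell.point, sidePoint] at h₁ h₂; done)
      | (exfalso; simp [Cell.point, sidePoint] at h₁ h₂; linarith)

set_option maxHeartbeats 4000000 in
theorem Cell.eq_of_contains_outside {x : ℝ × ℝ} {a b : Cell} (ha : a.Contains (1 / 2, 2) x)
    (hb : b.Contains (1 / 2, 2) x) : a = b ∨ (a = bridge ∧ b = side 3) ∨
      (a = side 3 ∧ b = bridge) := by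
  obtain ⟨s, τ, ⟨hs₀, hs₁, hτ₀, hτ₁, hτ₂⟩, ha⟩ := ha
  obtain ⟨s', τ', ⟨hs'₀, hs'₁, hτ'₀, hτ'₁, hτ'₂⟩, hb⟩ := hb
  rw [ha, Prod.ext_iff] at hb
  clear ha
  obtain ⟨h₁, h₂⟩ := hb
  have key : ∀ i : Fin 6, i = 0 ∨ i = 1 ∨ i = 2 ∨ i = 3 ∨ i = 4 ∨ i = 5 := by decide
  rcases a with i | i | i | (_ | _) | _ <;>
    (try obtain rfl | rfl | rfl | rfl | rfl | rfl := key i) <;>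
    rcases b with i | i | i | (_ | _) | _ <;>
      (try obtain rfl | rfl | rfl | rfl | rfl | rfl := key i) <;> first
      | exact Or.inl rfl
      | exact Or.inr (Or.inl ⟨rfl, rfl⟩)
      | exact Or.inr (Or.inr ⟨rfl, rfl⟩)
      | (exfalso; simp [Cell.point, sidePoint] at h₁ h₂; done)
      | (exfalso; simp [Cell.point, sidePoint] at h₁ h₂; linarith)

theorem sidePoint_inj {i : Fin 6} {s τ s' τ' : ℝ} (h : sidePoint i s τ = sidePoint i s' τ') :
    s = s' ∧ τ = τ' := by
  obtain ⟨h₁, h₂⟩ := Prod.ext_iff.1 h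
  fin_cases i <;> simp [sidePoint] at h₁ h₂ <;> constructor <;> linarith

theorem Node.eq_of_cell_eq {q : ℝ × ℝ} {v w : Node ℓ} (hc : v.cell = w.cell)
    (h : v.pos q = w.pos q) : v = w := by
  cases v <;> cases w <;> simp_all [cell]
  exact height_injective (sidePoint_inj h).2

theorem Link.notMem_trace_of_cell_eq {q : ℝ × ℝ} {v : Node ℓ} {e : Link ℓ}
    (hc : v.cell = e.cell) : v.pos q ∉ e.trace q := by
  intro h
  rcases v with _ | ⟨i, j⟩ | _ <;> rcases e with ⟨i', j', b⟩ | _ | _ <;>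
    simp [Node.cell, Link.cell] at hc
  subst hc
  obtain ⟨t, ht, h⟩ := mem_trace_half.1 h
  have := (sidePoint_inj h).1
  cases b <;> simp at this <;> linarith

theorem Link.eq_of_cell_eq {q x : ℝ × ℝ} {e f : Link ℓ} (hc : e.cell = f.cell)
    (he : x ∈ e.trace q) (hf : x ∈ f.trace q) : e = f := by
  rcases e with ⟨i, j, b⟩ | _ | _ <;> rcases f with ⟨i', j', b'⟩ | _ | _ <;>
    simp [cell] at hc ⊢
  · subst hc
    obtain ⟨t, ht, rfl⟩ := mem_trace_half.1 he
    obtain ⟨t', ht', h⟩ := mem_trace_half.1 hf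
    obtain ⟨h₁, h₂⟩ := sidePoint_inj h
    obtain ⟨rfl, rfl⟩ : b = b' ∧ t = t' := by
      cases b <;> cases b' <;> simp at h₁ ⊢ <;> linarith
    exact ⟨rfl, height_injective (mul_left_cancel₀ ht.1.ne' h₂), rfl⟩
  · exact hc

/-- Placing the second hub at `q` yields a drawing of the gadget. -/
structure IsLayout (ℓ : ℕ) (q : ℝ × ℝ) : Prop where
  pos_injective : Function.Injective (Node.pos (ℓ := ℓ) q)
  abs_pos_le : ∀ v : Node ℓ, |(v.pos q).1| ≤ 2
  notMem_trace : ∀ (v : Node ℓ) (e : Link ℓ), v.pos q ∉ e.trace q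
  subsingleton : ∀ e f : Link ℓ, e ≠ f → (e.trace q ∩ f.trace q).Subsingleton
  no_triple : ∀ (e f g : Link ℓ) (x : ℝ × ℝ), e ≠ f → e ≠ g → f ≠ g → x ∈ e.trace q →
    x ∈ f.trace q → x ∉ g.trace q

theorem Node.abs_pos_le {q : ℝ × ℝ} (hq : |q.1| ≤ 2) (v : Node ℓ) : |(v.pos q).1| ≤ 2 := by
  rcases v with i | ⟨i, j⟩ | _ | _
  · fin_cases i <;> simp [pos, sidePoint]
  · have := height_pos j
    have := height_le j
    rw [abs_le]
    constructor <;> fin_cases i <;> simp [pos, sidePoint] <;> linarith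
  · simp [pos]
  · exact hq

namespace Link

theorem eq_of_mem_trace_inside {e f : Link ℓ} {x : ℝ × ℝ} (hef : e ≠ f)
    (he : x ∈ e.trace (0, -1)) (hf : x ∈ f.trace (0, -1)) :
    x = (-2 / 3, -2 / 3) ∧ (e = spoke 1 ∧ f = spoke 2 ∨ e = spoke 2 ∧ f = spoke 1) ∨
      x = (2 / 3, -2 / 3) ∧ (e = spoke 4 ∧ f = spoke 5 ∨ e = spoke 5 ∧ f = spoke 4) := by
  have key : ∀ (e : Link ℓ) i, e.cell = .spoke i → e = spoke i := by
    intro e i h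
    cases e <;> simp_all [cell]
  have h₁₂ : x ∈ (spoke 1 : Link ℓ).trace (0, -1) → x ∈ (spoke 2 : Link ℓ).trace (0, -1) →
      x = (-2 / 3, -2 / 3) := by
    intro h h'
    obtain ⟨t, ht, rfl⟩ := mem_openSegment_iff.1 h
    obtain ⟨t', ht', h⟩ := mem_openSegment_iff.1 h'
    obtain ⟨h₁, h₂⟩ := Prod.ext_iff.1 h
    simp [fst, snd, Node.pos, sidePoint] at h₁ h₂ ⊢
    constructor <;> linarith
  have h₄₅ : x ∈ (spoke 4 : Link ℓ).trace (0, -1) → x ∈ (spoke 5 : Link ℓ).trace (0, -1) →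
      x = (2 / 3, -2 / 3) := by
    intro h h'
    obtain ⟨t, ht, rfl⟩ := mem_openSegment_iff.1 h
    obtain ⟨t', ht', h⟩ := mem_openSegment_iff.1 h'
    obtain ⟨h₁, h₂⟩ := Prod.ext_iff.1 h
    simp [fst, snd, Node.pos, sidePoint] at h₁ h₂ ⊢
    constructor <;> linarith
  rcases Cell.eq_of_contains_inside (cell_contains he) (cell_contains hf) with
    h | ⟨h, h'⟩ | ⟨h, h'⟩ | ⟨h, h'⟩ | ⟨h, h'⟩
  · exact absurd (eq_of_cell_eq h he hf) hef
  all_goals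
    obtain rfl := key _ _ h
    obtain rfl := key _ _ h'
  · exact Or.inl ⟨h₁₂ he hf, Or.inl ⟨rfl, rfl⟩⟩
  · exact Or.inl ⟨h₁₂ hf he, Or.inr ⟨rfl, rfl⟩⟩
  · exact Or.inr ⟨h₄₅ he hf, Or.inl ⟨rfl, rfl⟩⟩
  · exact Or.inr ⟨h₄₅ hf he, Or.inr ⟨rfl, rfl⟩⟩

theorem eq_of_mem_trace_outside {e f : Link ℓ} {x : ℝ × ℝ} (hef : e ≠ f)
    (he : x ∈ e.trace (1 / 2, 2)) (hf : x ∈ f.trace (1 / 2, 2)) :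
    (e = bridge ∧ ∃ j b, f = half 3 j b) ∨ (f = bridge ∧ ∃ j b, e = half 3 j b) := by
  have hb : ∀ e : Link ℓ, e.cell = .bridge → e = bridge := by
    intro e h
    cases e <;> simp_all [cell]
  have hs : ∀ e : Link ℓ, e.cell = .side 3 → ∃ j b, e = half 3 j b := by
    intro e h
    cases e <;> simp_all [cell]
  rcases Cell.eq_of_contains_outside (cell_contains he) (cell_contains hf) with
    h | ⟨h, h'⟩ | ⟨h, h'⟩
  · exact absurd (eq_of_cell_eq h he hf) hef
  · exact Or.inl ⟨hb _ h, hs _ h'⟩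
  · exact Or.inr ⟨hb _ h', hs _ h⟩

theorem bridge_inter_half_subsingleton (j : Fin ℓ) (b : Bool) :
    ((bridge : Link ℓ).trace (1 / 2, 2) ∩ (half 3 j b).trace (1 / 2, 2)).Subsingleton := by
  have key : ∀ x ∈ (bridge : Link ℓ).trace (1 / 2, 2) ∩ (half 3 j b).trace (1 / 2, 2),
      ∃ t, x = (1 - t) • (0, -2) + t • (1 / 2, 2) ∧
        t = if b then (2 + 2 * height j) / (4 + height j) else 2 / (4 - height j) := by
    rintro x ⟨hx, hx'⟩
    obtain ⟨t, ht, rfl⟩ := mem_openSegment_iff.1 hx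
    obtain ⟨t', ht', h⟩ := mem_trace_half.1 hx'
    refine ⟨t, rfl, ?_⟩
    have h₀ := height_pos j
    have h₁ := height_le j
    obtain ⟨h₂, h₃⟩ := Prod.ext_iff.1 h
    cases b <;> simp [fst, snd, Node.pos, sidePoint] at h₂ h₃ ⊢
    · obtain rfl : t' = t := by linarith
      rw [eq_div_iff (by linarith)]
      linarith
    · obtain rfl : t' = 2 - t := by linarith
      rw [eq_div_iff (by linarith)]
      linarith
  intro x hx y hy
  obtain ⟨t, rfl, ht⟩ := key x hx
  obtain ⟨t', rfl, ht'⟩ := key y hy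
  rw [ht, ht']

end Link

theorem isLayout_inside : IsLayout ℓ (0, -1) where
  pos_injective v w h := by
    have hv := v.cell_contains (0, -1)
    rw [h] at hv
    refine Node.eq_of_cell_eq (q := (0, -1)) ?_ h
    rcases Cell.eq_of_contains_inside hv (w.cell_contains _) with h | h | h | h | h
    · exact h
    all_goals cases v <;> simp [Node.cell] at h
  abs_pos_le := Node.abs_pos_le (by simp)
  notMem_trace v e h := by
    refine Link.notMem_trace_of_cell_eq ?_ h
    rcases Cell.eq_of_contains_inside (v.cell_contains _) (Link.cell_contains h) with
      h | h | h | h | h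
    · exact h
    all_goals cases v <;> simp [Node.cell] at h
  subsingleton e f hef x hx y hy := by
    rcases Link.eq_of_mem_trace_inside hef hx.1 hx.2 with ⟨rfl, ⟨rfl, rfl⟩ | ⟨rfl, rfl⟩⟩ |
      ⟨rfl, ⟨rfl, rfl⟩ | ⟨rfl, rfl⟩⟩ <;>
    rcases Link.eq_of_mem_trace_inside hef hy.1 hy.2 with ⟨rfl, h⟩ | ⟨rfl, h⟩ <;>
      simp at h ⊢
  no_triple e f g x hef heg hfg he hf hg := by
    rcases Link.eq_of_mem_trace_inside hef he hf with ⟨-, ⟨rfl, rfl⟩ | ⟨rfl, rfl⟩⟩ |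
      ⟨-, ⟨rfl, rfl⟩ | ⟨rfl, rfl⟩⟩ <;>
    rcases Link.eq_of_mem_trace_inside heg he hg with ⟨-, h⟩ | ⟨-, h⟩ <;>
      simp at h <;> simp_all

theorem isLayout_outside : IsLayout ℓ (1 / 2, 2) where
  pos_injective v w h := by
    have hv := v.cell_contains (1 / 2, 2)
    rw [h] at hv
    refine Node.eq_of_cell_eq (q := (1 / 2, 2)) ?_ h
    rcases Cell.eq_of_contains_outside hv (w.cell_contains _) with h | h | h
    · exact h
    all_goals cases v <;> cases w <;> simp [Node.cell] at h
  abs_pos_le := Node.abs_pos_le (by norm_num [abs_le])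
  notMem_trace v e h := by
    refine Link.notMem_trace_of_cell_eq ?_ h
    rcases Cell.eq_of_contains_outside (v.cell_contains _) (Link.cell_contains h) with
      h' | h' | h'
    · exact h'
    · cases v <;> simp [Node.cell] at h'
    · rcases v with _ | ⟨i, j⟩ | _ <;> rcases e with _ | _ | _ <;>
        simp [Node.cell, Link.cell] at h'
      subst h'
      exfalso
      obtain ⟨t, ht, h⟩ := mem_openSegment_iff.1 h
      obtain ⟨h₁, h₂⟩ := Prod.ext_iff.1 h
      have := height_le j
      simp [Link.fst, Link.snd, Node.pos, sidePoint] at h₁ h₂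
      linarith
  subsingleton e f hef x hx y hy := by
    rcases Link.eq_of_mem_trace_outside hef hx.1 hx.2 with ⟨rfl, j, b, rfl⟩ | ⟨rfl, j, b, rfl⟩
    · exact Link.bridge_inter_half_subsingleton j b hx hy
    · exact Link.bridge_inter_half_subsingleton j b hx.symm hy.symm
  no_triple e f g x hef heg hfg he hf hg := by
    rcases Link.eq_of_mem_trace_outside hef he hf with ⟨rfl, j, b, rfl⟩ | ⟨rfl, j, b, rfl⟩
    · rcases Link.eq_of_mem_trace_outside hfg hf hg with ⟨h, -⟩ | ⟨rfl, -⟩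
      · simp at h
      · exact heg rfl
    · rcases Link.eq_of_mem_trace_outside heg he hg with ⟨h, -⟩ | ⟨rfl, -⟩
      · simp at h
      · exact hfg rfl

/-- The graph formed by `k` copies of the gadget on the vertices `ι (c, v)`. -/
def copies (ι : Fin k × Node ℓ ↪ V) : SimpleGraph V where
  Adj u v := ∃ s, copyEdge ι s = s(u, v)
  symm := ⟨fun _ _ ⟨s, hs⟩ => ⟨s, hs.trans Sym2.eq_swap⟩⟩
  loopless := ⟨by
    rintro u ⟨⟨c, e⟩, hs⟩
    have : (copyEdge ι (c, e)).IsDiag := by rw [hs]; rfl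
    exact e.fst_ne_snd (congrArg Prod.snd (ι.injective this))⟩

theorem mem_edgeSet_copies {ι : Fin k × Node ℓ ↪ V} {e : Sym2 V} :
    e ∈ (copies ι).edgeSet ↔ ∃ s, copyEdge ι s = e := by
  induction e with | _ u v => rfl

/-- `P` places the copies of the gadget side by side, with their second hubs at translates of `q`,
and all other vertices to their left. -/
structure IsPlacement (ι : Fin k × Node ℓ ↪ V) (q : ℝ × ℝ) (P : V → ℝ × ℝ) : Prop where
  injective : Function.Injective P
  apply_copy : ∀ c v, P (ι (c, v)) = v.pos q + (10 * (c.val : ℝ), 0)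
  lt_of_notMem : ∀ w ∉ Set.range ι, (P w).1 < -2

namespace IsPlacement

variable {ι : Fin k × Node ℓ ↪ V} {q : ℝ × ℝ} {P : V → ℝ × ℝ}

theorem openSegment_eq (hP : IsPlacement ι q P) {s : Fin k × Link ℓ} {u v : V}
    (h : copyEdge ι s = s(u, v)) {x : ℝ × ℝ} :
    x ∈ openSegment ℝ (P u) (P v) ↔ x - (10 * (s.1.val : ℝ), 0) ∈ s.2.trace q := by
  have key : openSegment ℝ (P u) (P v) =
      openSegment ℝ (P (ι (s.1, s.2.fst))) (P (ι (s.1, s.2.snd))) := by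
    rcases Sym2.eq_iff.1 h with ⟨rfl, rfl⟩ | ⟨rfl, rfl⟩
    · rfl
    · exact openSegment_symm _ _ _
  rw [key, hP.apply_copy, hP.apply_copy, Link.trace, add_comm, add_comm (s.2.snd.pos q),
    ← openSegment_translate_image ℝ (10 * (s.1.val : ℝ), (0 : ℝ))]
  constructor
  · rintro ⟨y, hy, rfl⟩
    simpa using hy
  · intro hx
    exact ⟨_, hx, by simp⟩

theorem mem_trace_of_mem_segment (hP : IsPlacement ι q P) {s : Fin k × Link ℓ} {u v : V}
    (h : copyEdge ι s = s(u, v)) {x : ℝ × ℝ} (hx : x ∈ segment ℝ (P u) (P v))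
    (hx' : x ∉ Set.range P) : x - (10 * (s.1.val : ℝ), 0) ∈ s.2.trace q := by
  rw [← hP.openSegment_eq h]
  exact mem_openSegment_of_ne_left_right (fun h => hx' ⟨u, h⟩) (fun h => hx' ⟨v, h⟩) hx

end IsPlacement

theorem IsLayout.abs_le_of_mem_trace {q x : ℝ × ℝ} (hq : IsLayout ℓ q) {e : Link ℓ}
    (hx : x ∈ e.trace q) : |x.1| ≤ 2 := by
  obtain ⟨t, ht, rfl⟩ := mem_openSegment_iff.1 hx
  have h₁ := abs_le.1 (hq.abs_pos_le e.fst)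
  have h₂ := abs_le.1 (hq.abs_pos_le e.snd)
  rw [abs_le]
  constructor <;> simp only [Prod.fst_add, Prod.smul_fst, smul_eq_mul] <;> nlinarith

theorem eq_of_abs_sub_le {a b : ℕ} {x : ℝ} (ha : |x - 10 * (a : ℝ)| ≤ 2)
    (hb : |x - 10 * (b : ℝ)| ≤ 2) : a = b := by
  rw [abs_le] at ha hb
  rcases lt_trichotomy a b with h | h | h
  · have : (a : ℝ) + 1 ≤ b := by exact_mod_cast h
    linarith
  · exact h
  · have : (b : ℝ) + 1 ≤ a := by exact_mod_cast h
    linarith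

namespace IsPlacement

variable {ι : Fin k × Node ℓ ↪ V} {q : ℝ × ℝ} {P : V → ℝ × ℝ}

theorem fst_eq (hP : IsPlacement ι q P) (hq : IsLayout ℓ q) {s s' : Fin k × Link ℓ} {u v w z : V}
    (hs : copyEdge ι s = s(u, v)) (hs' : copyEdge ι s' = s(w, z)) {x : ℝ × ℝ}
    (hx : x ∈ segment ℝ (P u) (P v)) (hx' : x ∈ segment ℝ (P w) (P z))
    (hxP : x ∉ Set.range P) : s.1 = s'.1 := by
  have h₁ := hq.abs_le_of_mem_trace (hP.mem_trace_of_mem_segment hs hx hxP)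
  have h₂ := hq.abs_le_of_mem_trace (hP.mem_trace_of_mem_segment hs' hx' hxP)
  exact Fin.ext (eq_of_abs_sub_le h₁ h₂)

theorem notMem_openSegment (hP : IsPlacement ι q P) (hq : IsLayout ℓ q) {u v : V}
    (h : (copies ι).Adj u v) : ∀ x ∈ openSegment ℝ (P u) (P v), x ∉ Set.range P := by
  obtain ⟨⟨c, e⟩, hs⟩ := h
  rintro x hx ⟨w, rfl⟩
  rw [hP.openSegment_eq hs] at hx
  have hx₁ := hq.abs_le_of_mem_trace hx
  by_cases hw : w ∈ Set.range ι
  · obtain ⟨⟨c', v⟩, rfl⟩ := hw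
    have hx₂ : |(P (ι (c', v))).1 - 10 * (c'.val : ℝ)| ≤ 2 := by
      simpa [hP.apply_copy] using hq.abs_pos_le v
    obtain rfl : c = c' := Fin.ext (eq_of_abs_sub_le hx₁ hx₂)
    refine hq.notMem_trace v e ?_
    simpa [hP.apply_copy] using hx
  · have h₁ := hP.lt_of_notMem w hw
    have h₂ := (abs_le.1 hx₁).1
    have : (0 : ℝ) ≤ c.val := Nat.cast_nonneg _
    simp only [Prod.fst_sub] at h₂
    linarith

theorem inter_finite [Finite V] (hP : IsPlacement ι q P) (hq : IsLayout ℓ q) {u v w z : V}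
    (h : (copies ι).Adj u v) (h' : (copies ι).Adj w z) (hne : s(u, v) ≠ s(w, z)) :
    (segment ℝ (P u) (P v) ∩ segment ℝ (P w) (P z)).Finite := by
  obtain ⟨⟨c, e⟩, hs⟩ := h
  obtain ⟨⟨c', e'⟩, hs'⟩ := h'
  have hsub : ((segment ℝ (P u) (P v) ∩ segment ℝ (P w) (P z)) \ Set.range P).Subsingleton := by
    rintro x ⟨⟨hx, hx'⟩, hxP⟩ y ⟨⟨hy, hy'⟩, hyP⟩
    obtain rfl : c = c' := hP.fst_eq hq hs hs' hx hx' hxP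
    have hee' : e ≠ e' := by
      rintro rfl
      exact hne (hs.symm.trans hs')
    exact sub_left_injective (hq.subsingleton e e' hee'
      ⟨hP.mem_trace_of_mem_segment hs hx hxP, hP.mem_trace_of_mem_segment hs' hx' hxP⟩
      ⟨hP.mem_trace_of_mem_segment hs hy hyP, hP.mem_trace_of_mem_segment hs' hy' hyP⟩)
  exact (hsub.finite.union (Set.finite_range P)).subset (by simp)

theorem no_triple (hP : IsPlacement ι q P) (hq : IsLayout ℓ q) {x : ℝ × ℝ}
    (hx : x ∉ Set.range P) {u₁ v₁ u₂ v₂ u₃ v₃ : V} (h₁ : (copies ι).Adj u₁ v₁)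
    (h₂ : (copies ι).Adj u₂ v₂) (h₃ : (copies ι).Adj u₃ v₃) (h₁₂ : s(u₁, v₁) ≠ s(u₂, v₂))
    (h₁₃ : s(u₁, v₁) ≠ s(u₃, v₃)) (h₂₃ : s(u₂, v₂) ≠ s(u₃, v₃))
    (hx₁ : x ∈ segment ℝ (P u₁) (P v₁)) (hx₂ : x ∈ segment ℝ (P u₂) (P v₂)) :
    x ∉ segment ℝ (P u₃) (P v₃) := by
  intro hx₃
  obtain ⟨⟨c, e₁⟩, hs₁⟩ := h₁
  obtain ⟨⟨c₂, e₂⟩, hs₂⟩ := h₂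
  obtain ⟨⟨c₃, e₃⟩, hs₃⟩ := h₃
  obtain rfl : c = c₂ := hP.fst_eq hq hs₁ hs₂ hx₁ hx₂ hx
  obtain rfl : c = c₃ := hP.fst_eq hq hs₁ hs₃ hx₁ hx₃ hx
  refine hq.no_triple e₁ e₂ e₃ _ ?_ ?_ ?_ (hP.mem_trace_of_mem_segment hs₁ hx₁ hx)
    (hP.mem_trace_of_mem_segment hs₂ hx₂ hx) (hP.mem_trace_of_mem_segment hs₃ hx₃ hx)
  · rintro rfl
    exact h₁₂ (hs₁.symm.trans hs₂)
  · rintro rfl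
    exact h₁₃ (hs₁.symm.trans hs₃)
  · rintro rfl
    exact h₂₃ (hs₂.symm.trans hs₃)

theorem image_Icc (P : V → ℝ × ℝ) (u v : V) :
    (fun t : ℝ => (1 - t) • P u + t • P v) '' Set.Icc 0 1 = segment ℝ (P u) (P v) :=
  (segment_eq_image ℝ _ _).symm

/-- The straight-line drawing with vertices at the given positions. -/
def drawing [Finite V] (hP : IsPlacement ι q P) (hq : IsLayout ℓ q) : Drawing (copies ι) where
  vpos := P
  vpos_inj := hP.injective
  arc u v t := (1 - t) • P u + t • P v
  arc_symm u v t := by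
    rw [sub_sub_cancel, add_comm]
  arc_cont u v _ := by fun_prop
  arc_injOn u v h s _ t _ hst := by
    have hne : P v - P u ≠ 0 := sub_ne_zero.2 (hP.injective.ne h.ne')
    have : (s - t) • (P v - P u) = 0 := by
      have hst : (1 - s) • P u + s • P v = (1 - t) • P u + t • P v := hst
      rw [← sub_eq_zero] at hst
      rw [← hst]
      module
    exact sub_eq_zero.1 ((smul_eq_zero.1 this).resolve_right hne)
  arc_start u v _ := by simp
  arc_end u v _ := by simp
  arc_avoids u v h t ht := by
    refine hP.notMem_openSegment hq h _ ?_
    rw [openSegment_eq_image]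
    exact ⟨t, ht, rfl⟩
  inter_finite u v w z h h' hne := by
    rw [image_Icc, image_Icc]
    exact hP.inter_finite hq h h' hne
  no_triple_point x hx u₁ v₁ u₂ v₂ u₃ v₃ h₁ h₂ h₃ h₁₂ h₁₃ h₂₃ hx' := by
    rw [image_Icc, image_Icc, image_Icc] at hx'
    exact hP.no_triple hq hx h₁ h₂ h₃ h₁₂ h₁₃ h₂₃ hx'.1 hx'.2.1 hx'.2.2

theorem exists_of_crossing [Finite V] (hP : IsPlacement ι q P) (hq : IsLayout ℓ q) {e f : Sym2 V}
    {x : ℝ × ℝ} (h : (hP.drawing hq).Crossing e f x) : ∃ c e' f', e = copyEdge ι (c, e') ∧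
      f = copyEdge ι (c, f') ∧ e' ≠ f' ∧ x - (10 * (c.val : ℝ), 0) ∈ e'.trace q ∧
      x - (10 * (c.val : ℝ), 0) ∈ f'.trace q := by
  obtain ⟨he, hf, hne, hxe, hxf, hx⟩ := h
  obtain ⟨⟨c, e'⟩, hs⟩ := mem_edgeSet_copies.1 he
  obtain ⟨⟨c', f'⟩, hs'⟩ := mem_edgeSet_copies.1 hf
  induction e with | _ u v =>
  induction f with | _ w z =>
  replace hxe : x ∈ segment ℝ (P u) (P v) := image_Icc P u v ▸ hxe
  replace hxf : x ∈ segment ℝ (P w) (P z) := image_Icc P w z ▸ hxf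
  obtain rfl : c = c' := hP.fst_eq hq hs hs' hxe hxf hx
  refine ⟨c, e', f', hs.symm, hs'.symm, ?_, hP.mem_trace_of_mem_segment hs hxe hx,
    hP.mem_trace_of_mem_segment hs' hxf hx⟩
  rintro rfl
  exact hne (hs.symm.trans hs')

end IsPlacement

theorem exists_isPlacement {n : ℕ} (ι : Fin k × Node ℓ ↪ Fin n) {q : ℝ × ℝ} (hq : IsLayout ℓ q) :
    ∃ P, IsPlacement ι q P := by
  let P : Fin n → ℝ × ℝ := Function.extend ι
    (fun s => s.2.pos q + (10 * (s.1.val : ℝ), 0)) fun w => (-3 - (w.val : ℝ), 0)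
  have hι : ∀ c v, P (ι (c, v)) = v.pos q + (10 * (c.val : ℝ), 0) := fun c v =>
    ι.injective.extend_apply _ _ _
  have hlt : ∀ w ∉ Set.range ι, P w = (-3 - (w.val : ℝ), 0) := fun w hw =>
    Function.extend_apply' _ _ _ hw
  have hlt' : ∀ w ∉ Set.range ι, (P w).1 < -2 := fun w hw => by
    rw [hlt w hw]
    have : (0 : ℝ) ≤ w.val := Nat.cast_nonneg _
    simp only
    linarith
  have hge : ∀ c v, -2 ≤ (P (ι (c, v))).1 := fun c v => by
    rw [hι]
    have : (0 : ℝ) ≤ c.val := Nat.cast_nonneg _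
    have := (abs_le.1 (hq.abs_pos_le v)).1
    simp only [Prod.fst_add]
    linarith
  refine ⟨P, ?_, hι, hlt'⟩
  intro u w h
  by_cases hu : u ∈ Set.range ι <;> by_cases hw : w ∈ Set.range ι
  · obtain ⟨⟨c, v⟩, rfl⟩ := hu
    obtain ⟨⟨c', v'⟩, rfl⟩ := hw
    rw [hι, hι] at h
    have h₁ : |(v.pos q + (10 * (c.val : ℝ), 0)).1 - 10 * (c.val : ℝ)| ≤ 2 := by
      simpa using hq.abs_pos_le v
    have h₂ : |(v.pos q + (10 * (c.val : ℝ), 0)).1 - 10 * (c'.val : ℝ)| ≤ 2 := by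
      simpa [h] using hq.abs_pos_le v'
    obtain rfl : c = c' := Fin.ext (eq_of_abs_sub_le h₁ h₂)
    rw [hq.pos_injective (add_right_cancel h)]
  · obtain ⟨⟨c, v⟩, rfl⟩ := hu
    have := hge c v
    have := hlt' w hw
    rw [h] at *
    linarith
  · obtain ⟨⟨c, v⟩, rfl⟩ := hw
    have := hge c v
    have := hlt' u hu
    rw [h] at *
    linarith
  · rw [hlt u hu, hlt w hw] at h
    have := congrArg Prod.fst h
    simp only [sub_right_inj, Nat.cast_inj] at this
    exact Fin.ext this

theorem exists_drawing_isSkewness {n : ℕ} (ι : Fin k × Node ℓ ↪ Fin n) :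
    ∃ Γ : Drawing (copies ι), Γ.IsSkewness k := by
  obtain ⟨P, hP⟩ := exists_isPlacement ι isLayout_outside
  refine ⟨hP.drawing isLayout_outside, Finset.univ.image fun c => copyEdge ι (c, .bridge),
    Finset.card_image_le.trans_eq (Finset.card_fin k), ?_⟩
  rintro x ⟨e, f, h⟩
  obtain ⟨c, e', f', rfl, rfl, hne, hx, hx'⟩ := hP.exists_of_crossing _ h
  rcases Link.eq_of_mem_trace_outside hne hx hx' with ⟨rfl, -⟩ | ⟨rfl, -⟩
  · exact ⟨_, Finset.mem_image_of_mem _ (Finset.mem_univ c), _, h⟩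
  · exact ⟨_, Finset.mem_image_of_mem _ (Finset.mem_univ c), _, h.2.1, h.1, h.2.2.1.symm,
      h.2.2.2.2.1, h.2.2.2.1, h.2.2.2.2.2⟩

theorem exists_drawing_crossings_le {n : ℕ} (ι : Fin k × Node ℓ ↪ Fin n) :
    ∃ Γ : Drawing (copies ι), Γ.crossings ≤ 2 * k := by
  obtain ⟨P, hP⟩ := exists_isPlacement ι isLayout_inside
  refine ⟨hP.drawing isLayout_inside, ?_⟩
  let X : Finset (ℝ × ℝ) := (Finset.univ ×ˢ {(-2 / 3, -2 / 3), (2 / 3, -2 / 3)}).image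
    fun p : Fin k × (ℝ × ℝ) => p.2 + (10 * (p.1.val : ℝ), 0)
  have hX : (hP.drawing isLayout_inside).crossingSet ⊆ X := by
    rintro x ⟨e, f, h⟩
    obtain ⟨c, e', f', rfl, rfl, hne, hx, hx'⟩ := hP.exists_of_crossing _ h
    refine Finset.mem_coe.2 (Finset.mem_image.2
      ⟨(c, x - (10 * (c.val : ℝ), 0)), ?_, sub_add_cancel _ _⟩)
    rcases Link.eq_of_mem_trace_inside hne hx hx' with ⟨h, -⟩ | ⟨h, -⟩ <;> simp [h]
  calc (hP.drawing isLayout_inside).crossings ≤ (X : Set (ℝ × ℝ)).ncard :=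
        Set.ncard_le_ncard hX X.finite_toSet
    _ = X.card := Set.ncard_coe_finset X
    _ ≤ k * 2 := by
        refine Finset.card_image_le.trans ?_
        rw [Finset.card_product, Finset.card_fin]
        exact Nat.mul_le_mul_left k Finset.card_le_two
    _ = 2 * k := mul_comm k 2

/-- The vertices of the gadget, by kind. -/
def Node.equivSum (ℓ : ℕ) : Node ℓ ≃ Fin 6 ⊕ Fin 6 × Fin ℓ ⊕ Bool where
  toFun
    | corner i => .inl i
    | mid i j => .inr (.inl (i, j))
    | hub b => .inr (.inr b)
  invFun
    | .inl i => corner i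
    | .inr (.inl (i, j)) => mid i j
    | .inr (.inr b) => hub b
  left_inv v := by cases v <;> rfl
  right_inv v := by rcases v with _ | _ | _ <;> rfl

theorem exists_embedding {n : ℕ} (h : k * (6 * ℓ + 8) ≤ n) :
    Nonempty (Fin k × Node ℓ ↪ Fin n) := by
  have : Nonempty (Fin k × (Fin 6 ⊕ Fin 6 × Fin ℓ ⊕ Bool) ↪ Fin n) := by
    refine Function.Embedding.nonempty_of_card_le ?_
    simp only [Fintype.card_prod, Fintype.card_sum, Fintype.card_fin, Fintype.card_bool]
    exact le_of_eq_of_le (by ring) h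
  exact this.map fun f => ((Equiv.refl _).prodCongr (Node.equivSum ℓ)).toEmbedding.trans f

/-- For all `k ≥ 1` and `ℓ ≥ 3` there exists a skewness-`k`
simple graph on exactly `n = 11ℓk - 5k + 1` vertices with
`cr_{skew-k}(G) ≥ ℓk` and `cr(G) ≤ 3k` (hence the skewness-`k` crossing ratio
is `Ω(n/k)`). -/
theorem skewness_k_crossing_ratio_lower (k ℓ : ℕ) (hk : 1 ≤ k) (hℓ : 3 ≤ ℓ) :
    ∃ G : SimpleGraph (Fin (11 * ℓ * k - 5 * k + 1)),
      (∃ Γ : Drawing G, Γ.IsSkewness k) ∧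
      ℓ * k ≤ crNumRestricted G (fun Γ => Γ.IsSkewness k) ∧
      crNum G ≤ 3 * k := by
  have h3k : 3 * k ≤ ℓ * k := Nat.mul_le_mul_right k hℓ
  have hn : k * (6 * ℓ + 8) ≤ 11 * ℓ * k - 5 * k + 1 := by
    rw [show k * (6 * ℓ + 8) = 6 * (ℓ * k) + 8 * k by ring, mul_assoc 11]
    omega
  obtain ⟨ι⟩ := exists_embedding hn
  refine ⟨copies ι, exists_drawing_isSkewness ι, ?_, ?_⟩
  · obtain ⟨Γ, hΓ⟩ := exists_drawing_isSkewness ι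
    refine le_csInf ⟨_, Γ, hΓ, rfl⟩ ?_
    rintro _ ⟨Γ', hΓ', rfl⟩
    exact le_crossings_of_isSkewness Γ' ι.injective (fun s => mem_edgeSet_copies.2 ⟨s, rfl⟩)
      (by omega) hΓ'
  · obtain ⟨Γ, hΓ⟩ := exists_drawing_crossings_le ι
    exact le_trans (Nat.sInf_le ⟨Γ, rfl⟩) (hΓ.trans (Nat.mul_le_mul_right k (by norm_num)))
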